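/- If a safety and Emerson-Lei formula φ = φ_safety ∧ φ_EL over AP = I ⊎ O is realizable, then it is realized by a finite-state strategy: there is a Mealy machine (finite-state transducer from 2^I to 2^O) with at most 2^{2^n} · e · m! states, where n = |φ_safety| and m = |φ_EL|, all of whose input-output words satisfy φ. -/

import Mathlib

/-- LTL formulas over atomic propositions `AP`, built from `⊤`, `⊥`, atoms, negation,
conjunction, disjunction and the temporal operators `X` (next), `U` (until),
`R` (release, the dual of until), `F` (eventually) and `G` (globally). -/
inductive LTL (AP : Type) : Type
  | tt : LTL AP
  | ff : LTL AP
  | atom : AP → LTL AP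
  | not : LTL AP → LTL AP
  | and : LTL AP → LTL AP → LTL AP
  | or : LTL AP → LTL AP → LTL AP
  | next : LTL AP → LTL AP
  | untl : LTL AP → LTL AP → LTL AP
  | release : LTL AP → LTL AP → LTL AP
  | ev : LTL AP → LTL AP
  | glob : LTL AP → LTL AP

/-- The usual satisfaction relation of LTL over infinite words `w ∈ (2^AP)^ω`;
`release` is the dual of `untl`: `φ R ψ = ¬(¬φ U ¬ψ)`. -/
def LTLSat {AP : Type} (w : ℕ → Set AP) : LTL AP → Prop
  | .tt => True
  | .ff => False
  | .atom p => p ∈ w 0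
  | .not f => ¬ LTLSat w f
  | .and f g => LTLSat w f ∧ LTLSat w g
  | .or f g => LTLSat w f ∨ LTLSat w g
  | .next f => LTLSat (fun n => w (n + 1)) f
  | .untl f g => ∃ i : ℕ, LTLSat (fun n => w (n + i)) g ∧
      ∀ j < i, LTLSat (fun n => w (n + j)) f
  | .release f g => ∀ i : ℕ, LTLSat (fun n => w (n + i)) g ∨
      ∃ j < i, LTLSat (fun n => w (n + j)) f
  | .ev f => ∃ i : ℕ, LTLSat (fun n => w (n + i)) f
  | .glob f => ∀ i : ℕ, LTLSat (fun n => w (n + i)) f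

/-- Safety LTL formulas: formulas in negative normal form (negation applied only to
atomic propositions) using only the temporal operators `X`, `R` and `G`
(no `U` and no `F`). -/
def IsSafety {AP : Type} : LTL AP → Prop
  | .tt => True
  | .ff => True
  | .atom _ => True
  | .not (.atom _) => True
  | .not _ => False
  | .and f g => IsSafety f ∧ IsSafety g
  | .or f g => IsSafety f ∧ IsSafety g
  | .next f => IsSafety f
  | .untl _ _ => False
  | .release f g => IsSafety f ∧ IsSafety g
  | .ev _ => False
  | .glob f => IsSafety f

/-- The size of an LTL formula (its number of subformula occurrences). -/
def LTL.size {AP : Type} : LTL AP → ℕ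
  | .tt => 1
  | .ff => 1
  | .atom _ => 1
  | .not f => f.size + 1
  | .and f g => f.size + g.size + 1
  | .or f g => f.size + g.size + 1
  | .next f => f.size + 1
  | .untl f g => f.size + g.size + 1
  | .release f g => f.size + g.size + 1
  | .ev f => f.size + 1
  | .glob f => f.size + 1

/-- A symbolic safety automaton `A = (2^AP, V, T, θ₀)`: a finite set `Var` of Boolean
variables, an initialization assertion on variable assignments, and a transition
assertion relating an assignment, a successor assignment, and a letter. -/
structure SymbSafetyAut (AP : Type) where
  Var : Type
  [finVar : Fintype Var]
  init : Set Var → Prop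
  trans : Set Var → Set Var → Set AP → Prop

attribute [instance] SymbSafetyAut.finVar

/-- A run of a symbolic safety automaton on a word: an infinite sequence of variable
assignments starting in an initial assignment and following the transition assertion. -/
def SymbSafetyAut.IsRun {AP : Type} (D : SymbSafetyAut AP)
    (w : ℕ → Set AP) (ρ : ℕ → Set D.Var) : Prop :=
  D.init (ρ 0) ∧ ∀ i, D.trans (ρ i) (ρ (i + 1)) (w i)

/-- The language of a symbolic safety automaton: the words on which an infinite run
exists. -/
def SymbSafetyAut.Lang {AP : Type} (D : SymbSafetyAut AP) : Set (ℕ → Set AP) :=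
  {w | ∃ ρ : ℕ → Set D.Var, D.IsRun w ρ}

/-- A symbolic safety automaton is deterministic if it has at most one initial assignment
and at most one successor assignment for each assignment and letter. -/
def SymbSafetyAut.Deterministic {AP : Type} (D : SymbSafetyAut AP) : Prop :=
  (∀ s s' : Set D.Var, D.init s → D.init s' → s = s') ∧
  ∀ (s s₁ s₂ : Set D.Var) (a : Set AP), D.trans s s₁ a → D.trans s s₂ a → s₁ = s₂

/-- Boolean (state) formulas: LTL formulas without temporal operators. -/
def IsBool {AP : Type} : LTL AP → Prop
  | .tt => True
  | .ff => True
  | .atom _ => True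
  | .not f => IsBool f
  | .and f g => IsBool f ∧ IsBool g
  | .or f g => IsBool f ∧ IsBool g
  | _ => False

/-- The Emerson-Lei fragment of LTL: positive Boolean combinations of formulas `GF ψ`
and `FG ψ'` for Boolean formulas `ψ`, `ψ'` over the atomic propositions
(`FG ¬ψ` is covered since `¬ψ` is Boolean whenever `ψ` is). -/
def IsEL {AP : Type} : LTL AP → Prop
  | .and f g => IsEL f ∧ IsEL g
  | .or f g => IsEL f ∧ IsEL g
  | .glob (.ev ψ) => IsBool ψ
  | .ev (.glob ψ) => IsBool ψ
  | _ => False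

/-- Combine an input valuation and an output valuation into a letter over `I ⊎ O`. -/
def combine {I O : Type} (x : Set I) (o : Set O) : Set (I ⊕ O) :=
  Sum.inl '' x ∪ Sum.inr '' o

/-- Realizability of an LTL formula over `AP = I ⊎ O`: there is a strategy
`σ : (2^I)^+ → 2^O` such that for every infinite input sequence the resulting
combined word satisfies `φ`. -/
def Realizable {I O : Type} (φ : LTL (I ⊕ O)) : Prop :=
  ∃ σ : List (Set I) → Set O, ∀ x : ℕ → Set I,
    LTLSat (fun n => combine (x n) (σ ((List.range (n + 1)).map x))) φ

/-- The system (existential player) wins the symbolic game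
`G_φ = ⟨V ⊎ AP, I, O ⊎ V, θ₀, T, ψ⟩` built from a symbolic safety automaton `D` and an
Emerson-Lei winning condition `ψ`: there is a strategy mapping each nonempty input
history to an output valuation and a valuation of the automaton variables such that,
along every input sequence, the initial variable valuation satisfies `θ₀`, every step
satisfies the transition assertion `T` (reading the combined input/output letter), and
the induced word over `2^AP` satisfies `ψ`. -/
def SystemWins {I O : Type} (D : SymbSafetyAut (I ⊕ O)) (ψ : LTL (I ⊕ O)) : Prop :=
  ∃ τ : List (Set I) → Set O × Set D.Var,
    ∀ x : ℕ → Set I,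
      D.init (τ ((List.range 1).map x)).2 ∧
      (∀ n : ℕ,
        D.trans (τ ((List.range (n + 1)).map x)).2 (τ ((List.range (n + 2)).map x)).2
          (combine (x n) (τ ((List.range (n + 1)).map x)).1)) ∧
      LTLSat (fun n => combine (x n) (τ ((List.range (n + 1)).map x)).1) ψ

/-- A Mealy machine (finite-state transducer from `2^I` to `2^O`): a finite state set,
an initial state, a transition function and an output function. -/
structure Mealy (I O : Type) where
  M : Type
  [finM : Fintype M]
  m0 : M
  δ : M → Set I → M
  out : M → Set I → Set O

attribute [instance] Mealy.finM

/-- The state of a Mealy machine after reading the inputs `x 0, …, x (n-1)`. -/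
def Mealy.stateAt {I O : Type} (Mm : Mealy I O) (x : ℕ → Set I) : ℕ → Mm.M
  | 0 => Mm.m0
  | n + 1 => Mm.δ (Mm.stateAt x n) (x n)

/-- A Mealy machine realizes `φ`: for every input sequence, the combined input-output
word it produces satisfies `φ`. -/
def Mealy.Realizes {I O : Type} (Mm : Mealy I O) (φ : LTL (I ⊕ O)) : Prop :=
  ∀ x : ℕ → Set I,
    LTLSat (fun n => combine (x n) (Mm.out (Mm.stateAt x n) (x n))) φ

/-- Max-parity acceptance: no odd number is both an eventual upper bound of the priorities
and attained infinitely often. -/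
def ParityWin (p : ℕ → ℕ) : Prop :=
  ∀ t, Odd t → (∀ᶠ n in Filter.atTop, p n ≤ t) → ¬ ∃ᶠ n in Filter.atTop, p n = t

namespace ParityGame

variable {A B S : Type}

/-- The `n`-th output of a strategy on an input sequence. -/
def outAt (σ : List A → B) (x : ℕ → A) (n : ℕ) : B := σ ((List.range (n + 1)).map x)

/-- The state of the arena after `n` rounds played according to a strategy. -/
def runAt (σ : List A → B) (step : S → A → B → S) (s0 : S) (x : ℕ → A) : ℕ → S
  | 0 => s0
  | n + 1 => step (runAt σ step s0 x n) (x n) (outAt σ x n)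

/-- The priority of the `n`-th round played according to a strategy. -/
def prAt (σ : List A → B) (step : S → A → B → S) (s0 : S) (prio : S → A → B → ℕ)
    (x : ℕ → A) (n : ℕ) : ℕ :=
  prio (runAt σ step s0 x n) (x n) (outAt σ x n)

variable (σ : List A → B) (step : S → A → B → S) (s0 : S) (prio : S → A → B → ℕ)

lemma outAt_congr {x y : ℕ → A} {n : ℕ} (h : ∀ i < n + 1, x i = y i) :
    outAt σ x n = outAt σ y n := by
  unfold outAt
  congr 1
  exact List.map_congr_left fun i hi => h i (List.mem_range.1 hi)

lemma runAt_congr {x y : ℕ → A} {n : ℕ} (h : ∀ i < n, x i = y i) :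
    runAt σ step s0 x n = runAt σ step s0 y n := by
  induction n with
  | zero => rfl
  | succ n ih =>
    simp only [runAt]
    rw [ih fun i hi => h i (by omega), outAt_congr σ h, h n (by omega)]

lemma prAt_congr {x y : ℕ → A} {n : ℕ} (h : ∀ i < n + 1, x i = y i) :
    prAt σ step s0 prio x n = prAt σ step s0 prio y n := by
  unfold prAt
  rw [runAt_congr σ step s0 fun i hi => h i (by omega), outAt_congr σ h, h n (by omega)]

/-- `Desc t v u`: `t` is odd and the history `v` (an input sequence cut at a length) properly
extends `u` by rounds of priority at most `t`, at least one of which has priority `t`. -/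
def Desc (t : ℕ) (v u : (ℕ → A) × ℕ) : Prop :=
  Odd t ∧ (∀ i < u.2, v.1 i = u.1 i) ∧
    (∀ i, u.2 ≤ i → i < v.2 → prAt σ step s0 prio v.1 i ≤ t) ∧
    ∃ i, u.2 ≤ i ∧ i < v.2 ∧ prAt σ step s0 prio v.1 i = t

lemma wellFounded_desc (hwin : ∀ x, ParityWin (prAt σ step s0 prio x)) (t : ℕ) :
    WellFounded (Desc σ step s0 prio t) := by
  rw [wellFounded_iff_isEmpty_descending_chain]
  refine ⟨fun ⟨f, hf⟩ => ?_⟩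
  have hlt (n : ℕ) : (f n).2 < (f (n + 1)).2 := by
    obtain ⟨i, hi, hi', -⟩ := (hf n).2.2.2
    omega
  have hmono : StrictMono fun n => (f n).2 := strictMono_nat_of_lt_succ hlt
  have hag (n m : ℕ) (hnm : n ≤ m) : ∀ i < (f n).2, (f m).1 i = (f n).1 i := by
    induction m, hnm using Nat.le_induction with
    | base => intro i _; rfl
    | succ m hm ih =>
      intro i hi
      rw [(hf m).2.1 i (hi.trans_le (hmono.monotone hm)), ih i hi]
  let z : ℕ → A := fun i => (f (i + 1)).1 i
  have hz (n i : ℕ) (hi : i < (f n).2) : z i = (f n).1 i := by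
    have hi' : i < (f (i + 1)).2 := (Nat.lt_succ_self i).trans_le (hmono.id_le (i + 1))
    rcases le_total n (i + 1) with h | h
    · exact hag n (i + 1) h i hi
    · exact (hag (i + 1) n h i hi').symm
  have hpz (n i : ℕ) (hi : i < (f n).2) :
      prAt σ step s0 prio z i = prAt σ step s0 prio (f n).1 i :=
    prAt_congr σ step s0 prio fun j hj => hz n j (by omega)
  refine hwin z t (hf 0).1 ?_ ?_
  · refine Filter.eventually_atTop.2 ⟨(f 0).2, fun i hi => ?_⟩
    have key (n : ℕ) : i < (f n).2 → prAt σ step s0 prio z i ≤ t := by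
      induction n with
      | zero => intro h; omega
      | succ n ih =>
        intro h
        by_cases h' : i < (f n).2
        · exact ih h'
        · rw [hpz (n + 1) i h]
          exact (hf n).2.2.1 i (by omega) h
    exact key (i + 1) ((Nat.lt_succ_self i).trans_le (hmono.id_le (i + 1)))
  · refine Filter.frequently_atTop.2 fun N => ?_
    obtain ⟨i, hi, hi', h⟩ := (hf N).2.2.2
    exact ⟨i, (hmono.id_le N).trans hi, (hpz (N + 1) i hi').trans h⟩

/-- The signature of a history: for each priority `t`, the ordinal rank of the history
with respect to `Desc t`, ordered lexicographically with high priorities first. -/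
noncomputable def sig (hwin : ∀ x, ParityWin (prAt σ step s0 prio x)) (d : ℕ)
    (u : (ℕ → A) × ℕ) : (Fin d)ᵒᵈ → Ordinal.{0} :=
  fun t => ((wellFounded_desc σ step s0 prio hwin (OrderDual.ofDual t : Fin d).val).apply u).rank

/-- Keep the entries at priorities at least `t`, and replace the others by `0`. -/
noncomputable def trunc {d : ℕ} (t : ℕ) (f : (Fin d)ᵒᵈ → Ordinal.{0}) : (Fin d)ᵒᵈ → Ordinal.{0} :=
  fun i => if t ≤ (OrderDual.ofDual i : Fin d) then f i else 0

lemma trunc_lex_mono {d : ℕ} (t : ℕ) {f g : (Fin d)ᵒᵈ → Ordinal.{0}} (h : toLex f ≤ toLex g) :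
    toLex (trunc t f) ≤ toLex (trunc t g) := by
  rcases h.eq_or_lt with h | ⟨i, hi, hlt⟩
  · rw [toLex_inj.1 h]
  by_cases ht : t ≤ (OrderDual.ofDual i : Fin d)
  · refine le_of_lt ⟨i, fun j hj => ?_, ?_⟩
    · have := hi j hj
      simp_all [trunc]
    · simpa [trunc, ht] using hlt
  · refine le_of_eq (congrArg _ (funext fun j => ?_))
    unfold trunc
    split_ifs with hj
    · refine hi j ?_
      have : (OrderDual.ofDual i : Fin d) < OrderDual.ofDual j := by
        rw [Fin.lt_def]; omega
      exact this
    · rfl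

lemma sig_child_le (hwin : ∀ x, ParityWin (prAt σ step s0 prio x)) (d : ℕ)
    {x y : ℕ → A} {n : ℕ} (hxy : ∀ i < n, y i = x i) (t : (Fin d)ᵒᵈ)
    (ht : prAt σ step s0 prio y n ≤ (OrderDual.ofDual t : Fin d)) :
    sig σ step s0 prio hwin d (y, n + 1) t ≤ sig σ step s0 prio hwin d (x, n) t := by
  refine le_of_forall_lt fun o ho => ?_
  unfold sig at ho
  rw [Acc.rank_eq, Ordinal.lt_iSup_iff] at ho
  obtain ⟨⟨v, hv⟩, ho⟩ := ho
  refine (Order.lt_succ_iff.1 ho).trans_lt (Acc.rank_lt_of_rel _ (a := v) ?_)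
  obtain ⟨hodd, hag, hle, i, hi, hi', heq⟩ := hv
  simp only at hag hle hi
  refine ⟨hodd, fun j hj => ?_, fun j hj hj' => ?_, i, ?_, hi', heq⟩
  · rw [hag j (Nat.lt_succ_of_lt hj), hxy j hj]
  · rcases Nat.lt_or_ge n j with h | h
    · exact hle j h hj'
    · obtain rfl : n = j := le_antisymm hj h
      exact (prAt_congr σ step s0 prio hag).trans_le ht
  · change n ≤ i
    omega

lemma sig_child_lt (hwin : ∀ x, ParityWin (prAt σ step s0 prio x)) (d : ℕ)
    {x y : ℕ → A} {n : ℕ} (hxy : ∀ i < n, y i = x i) (t : (Fin d)ᵒᵈ)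
    (hodd : Odd (OrderDual.ofDual t : Fin d).val)
    (ht : prAt σ step s0 prio y n = (OrderDual.ofDual t : Fin d)) :
    sig σ step s0 prio hwin d (y, n + 1) t < sig σ step s0 prio hwin d (x, n) t := by
  refine Acc.rank_lt_of_rel _ ⟨hodd, hxy, fun i hi hi' => ?_, n, le_rfl, Nat.lt_succ_self n, ht⟩
  obtain rfl : n = i := le_antisymm hi (Nat.lt_succ_iff.1 hi')
  exact ht.le

/-- If some strategy wins a parity game then some positional strategy does, and it only visits
states that the original strategy visits. -/
theorem exists_positional (d : ℕ) (hd : ∀ s a b, prio s a b < d)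
    (hwin : ∀ x, ParityWin (prAt σ step s0 prio x)) :
    ∃ out : S → A → B, ∀ (x : ℕ → A) (v : ℕ → S), v 0 = s0 →
      (∀ n, v (n + 1) = step (v n) (x n) (out (v n) (x n))) →
      (∀ n, ∃ y m, runAt σ step s0 y m = v n) ∧
      ParityWin fun n => prio (v n) (x n) (out (v n) (x n)) := by
  classical
  let lab : (ℕ → A) × ℕ → S := fun u => runAt σ step s0 u.1 u.2
  let sg : (ℕ → A) × ℕ → Lex ((Fin d)ᵒᵈ → Ordinal.{0}) :=
    fun u => toLex (sig σ step s0 prio hwin d u)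
  have hmin (s : S) (hs : ∃ u, lab u = s) :
      ∃ u, lab u = s ∧ ∀ u', lab u' = s → sg u ≤ sg u' := by
    obtain ⟨u, hu, hu'⟩ := (InvImage.wf sg wellFounded_lt).has_min {u | lab u = s} hs
    exact ⟨u, hu, fun u' h' => not_lt.1 (hu' u' h')⟩
  rcases isEmpty_or_nonempty (ℕ → A) with hA | ⟨⟨x0⟩⟩
  · exact ⟨fun _ _ => σ [], fun x => hA.elim x⟩
  have hmin' (s : S) : ∃ u, (∃ u, lab u = s) → lab u = s ∧ ∀ u', lab u' = s → sg u ≤ sg u' := by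
    by_cases hs : ∃ u, lab u = s
    · obtain ⟨u, hu⟩ := hmin s hs
      exact ⟨u, fun _ => hu⟩
    · exact ⟨(x0, 0), fun h => (hs h).elim⟩
  choose nd hnd using hmin'
  let ext : (ℕ → A) × ℕ → A → ℕ → A := fun u a => Function.update u.1 u.2 a
  have hext (u : (ℕ → A) × ℕ) (a : A) : ∀ i < u.2, ext u a i = u.1 i := fun i hi =>
    Function.update_of_ne hi.ne _ _
  have hext' (u : (ℕ → A) × ℕ) (a : A) : ext u a u.2 = a := Function.update_self _ _ _
  let out : S → A → B := fun s a => outAt σ (ext (nd s) a) (nd s).2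
  refine ⟨out, fun x v hv0 hv => ?_⟩
  have hstep (s : S) (hs : ∃ u, lab u = s) (a : A) :
      lab (ext (nd s) a, (nd s).2 + 1) = step s a (out s a) := by
    have h1 := (hnd s hs).1
    simp only [lab, runAt] at h1 ⊢
    rw [runAt_congr σ step s0 (hext (nd s) a), h1, hext']
  have hreach (n : ℕ) : ∃ u, lab u = v n := by
    induction n with
    | zero => exact ⟨(x0, 0), hv0.symm⟩
    | succ n ih => exact ⟨_, (hstep (v n) ih (x n)).trans (hv n).symm⟩
  refine ⟨fun n => ?_, ?_⟩
  · obtain ⟨u, hu⟩ := hreach n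
    exact ⟨u.1, u.2, hu⟩
  have hpr (n : ℕ) : prAt σ step s0 prio (ext (nd (v n)) (x n)) (nd (v n)).2 =
      prio (v n) (x n) (out (v n) (x n)) := by
    have h1 := (hnd (v n) (hreach n)).1
    simp only [lab] at h1
    unfold prAt
    rw [runAt_congr σ step s0 (hext (nd (v n)) (x n)), h1, hext']
  have hnext (n : ℕ) : sg (nd (v (n + 1))) ≤ sg (ext (nd (v n)) (x n), (nd (v n)).2 + 1) :=
    (hnd _ (hreach (n + 1))).2 _ ((hstep (v n) (hreach n) (x n)).trans (hv n).symm)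
  intro t hodd hev hfreq
  obtain ⟨N, hN⟩ := Filter.eventually_atTop.1 hev
  let X : ℕ → Lex ((Fin d)ᵒᵈ → Ordinal.{0}) := fun n =>
    toLex (trunc t (sig σ step s0 prio hwin d (nd (v n))))
  have htd : t < d := by
    obtain ⟨n, hn⟩ := hfreq.exists
    rw [← hn]
    exact hd _ _ _
  have hle (n : ℕ) (hn : N ≤ n) :
      trunc t (sig σ step s0 prio hwin d (ext (nd (v n)) (x n), (nd (v n)).2 + 1)) ≤
        trunc t (sig σ step s0 prio hwin d (nd (v n))) := by
    intro i
    unfold trunc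
    split_ifs with hi
    · exact sig_child_le σ step s0 prio hwin d (hext _ _) i
        ((hpr n).le.trans ((hN n hn).trans hi))
    · exact le_rfl
  have hX (n : ℕ) (hn : N ≤ n) : X (n + 1) ≤ X n :=
    (trunc_lex_mono t (hnext n)).trans (Pi.toLex_monotone (hle n hn))
  have hX' (n : ℕ) (hn : N ≤ n) (ht : prio (v n) (x n) (out (v n) (x n)) = t) :
      X (n + 1) < X n := by
    refine (trunc_lex_mono t (hnext n)).trans_lt (Pi.toLex_strictMono ?_)
    refine Pi.lt_def.2 ⟨hle n hn, OrderDual.toDual ⟨t, htd⟩, ?_⟩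
    have := sig_child_lt σ step s0 prio hwin d (hext (nd (v n)) (x n))
      (OrderDual.toDual ⟨t, htd⟩) hodd ((hpr n).trans ht)
    simpa [trunc] using this
  have hanti : Antitone fun n => X (N + n) :=
    antitone_nat_of_succ_le fun n => hX (N + n) (Nat.le_add_right _ _)
  obtain ⟨K, hK⟩ := WellFoundedLT.antitone_chain_condition hanti
  obtain ⟨n, hn, hnt⟩ := Filter.frequently_atTop.1 hfreq (N + K)
  obtain ⟨j, rfl⟩ := Nat.exists_eq_add_of_le hn
  have h1 := hK (K + j) (by omega)
  have h2 := hK (K + j + 1) (by omega)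
  have h3 := hX' (N + K + j) (by omega) hnt
  simp only [← Nat.add_assoc] at h1 h2
  rw [← h1, ← h2] at h3
  exact lt_irrefl _ h3

end ParityGame

namespace LatestAppearance

variable {κ : Type} [Fintype κ]

open Classical in
/-- Update of a latest appearance record, in which `r c` counts the colours seen more recently
than `c`, after seeing the set `C` of colours. -/
noncomputable def upd (r : κ → ℕ) (C : Set κ) (c : κ) : ℕ :=
  if c ∈ C then 0 else Finset.card {d | d ∈ C ∨ r d < r c}

/-- The colours seen at least as recently as some colour of `C`. -/
def hit (r : κ → ℕ) (C : Set κ) : Set κ := {d | ∃ c ∈ C, r d ≤ r c}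

open Classical in
/-- The priority of seeing the colours `C` in the record `r`, for a family `acc` of accepting
sets of colours. -/
noncomputable def prio (acc : Set κ → Prop) (r : κ → ℕ) (C : Set κ) : ℕ :=
  2 * (hit r C).ncard + if acc (hit r C) then 0 else 1

lemma upd_le (r : κ → ℕ) (C : Set κ) (c : κ) : upd r C c ≤ Fintype.card κ := by
  unfold upd
  split_ifs
  · exact Nat.zero_le _
  · exact Finset.card_le_univ _

lemma prio_lt (acc : Set κ → Prop) (r : κ → ℕ) (C : Set κ) :
    prio acc r C < 2 * Fintype.card κ + 2 := by
  have : (hit r C).ncard ≤ Fintype.card κ := by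
    rw [← Nat.card_eq_fintype_card]
    exact Set.ncard_le_card _
  unfold prio
  split_ifs <;> omega

lemma upd_lt_upd {r : κ → ℕ} {C : Set κ} {c d : κ} (hd : d ∉ C) (h : c ∈ C ∨ r c < r d) :
    upd r C c < upd r C d := by
  classical
  unfold upd
  rw [if_neg hd]
  split_ifs with hc
  · exact Finset.card_pos.2 ⟨c, by simp [hc]⟩
  · have hcd := h.resolve_left hc
    refine Finset.card_lt_card (Finset.ssubset_iff_of_subset ?_ |>.2 ⟨c, ?_, ?_⟩)
    · intro e he
      simp only [Finset.mem_filter, Finset.mem_univ, true_and] at he ⊢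
      exact he.imp_right fun he => he.trans hcd
    · simp [hcd]
    · simp [hc]

lemma upd_le_upd {r : κ → ℕ} {C : Set κ} {c d : κ} (hd : d ∉ C) (h : r c ≤ r d) :
    upd r C c ≤ upd r C d := by
  classical
  unfold upd
  rw [if_neg hd]
  split_ifs with hc
  · exact Nat.zero_le _
  · refine Finset.card_le_card fun e he => ?_
    simp only [Finset.mem_filter, Finset.mem_univ, true_and] at he ⊢
    exact he.imp_right fun he => he.trans_le h

variable {C : ℕ → Set κ} {r : ℕ → κ → ℕ}

lemma eventually_subset :
    ∀ᶠ n in Filter.atTop, C n ⊆ {c | ∃ᶠ n in Filter.atTop, c ∈ C n} := by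
  have : ∀ c : κ, ∀ᶠ n in Filter.atTop, c ∈ C n → ∃ᶠ n in Filter.atTop, c ∈ C n := by
    intro c
    by_cases h : ∃ᶠ n in Filter.atTop, c ∈ C n
    · exact Filter.Eventually.of_forall fun _ _ => h
    · filter_upwards [Filter.not_frequently.1 h] with n hn hn'
      exact (hn hn').elim
  filter_upwards [Filter.eventually_all.2 this] with n hn c hc
  exact hn c hc

lemma eventually_hit_subset (hr : ∀ n, r (n + 1) = upd (r n) (C n)) :
    ∀ᶠ n in Filter.atTop, hit (r n) (C n) ⊆ {c | ∃ᶠ n in Filter.atTop, c ∈ C n} := by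
  obtain ⟨N, hN⟩ := Filter.eventually_atTop.1 (eventually_subset (C := C))
  set F := {c | ∃ᶠ n in Filter.atTop, c ∈ C n} with hF
  have key : ∀ c ∈ F, ∀ᶠ n in Filter.atTop, ∀ d ∉ F, r n c < r n d := by
    intro c hc
    obtain ⟨m, hm, hcm⟩ := Filter.frequently_atTop.1 hc N
    refine Filter.eventually_atTop.2 ⟨m + 1, fun n hn => ?_⟩
    induction n, hn using Nat.le_induction with
    | base =>
      intro d hd
      rw [hr]
      exact upd_lt_upd (fun h => hd (hN m hm h)) (Or.inl hcm)
    | succ n hn ih =>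
      intro d hd
      rw [hr]
      exact upd_lt_upd (fun h => hd (hN n (by omega) h)) (Or.inr (ih d hd))
  have key' : ∀ᶠ n in Filter.atTop, ∀ c, c ∈ F → ∀ d ∉ F, r n c < r n d := by
    refine Filter.eventually_all.2 fun c => ?_
    by_cases hc : c ∈ F
    · filter_upwards [key c hc] with n hn _ using hn
    · exact Filter.Eventually.of_forall fun _ h => (hc h).elim
  filter_upwards [key', eventually_subset (C := C)] with n hn hC d ⟨c, hc, hdc⟩
  by_contra hd
  exact absurd (hn c (hC hc) d hd) (not_lt.2 hdc)

lemma frequently_subset_hit (hr : ∀ n, r (n + 1) = upd (r n) (C n)) :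
    ∃ᶠ n in Filter.atTop, {c | ∃ᶠ n in Filter.atTop, c ∈ C n} ⊆ hit (r n) (C n) := by
  set F := {c | ∃ᶠ n in Filter.atTop, c ∈ C n} with hF
  refine Filter.frequently_atTop.2 fun N => ?_
  rcases F.eq_empty_or_nonempty with h0 | hne
  · exact ⟨N, le_rfl, by simp [h0]⟩
  obtain ⟨c, hc, hmax⟩ := F.toFinite.exists_maximalFor (r N) F hne
  by_contra! hno
  have key (n : ℕ) (hn : N ≤ n) : ∀ d ∈ F, r n d ≤ r n c := by
    induction n, hn using Nat.le_induction with
    | base => exact fun d hd => (le_total (r N d) (r N c)).elim id fun h => hmax hd h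
    | succ n hn ih =>
      have hcn : c ∉ C n := fun h => hno n hn fun d hd => ⟨c, h, ih d hd⟩
      intro d hd
      rw [hr]
      exact upd_le_upd hcn (ih d hd)
  obtain ⟨m, hm, hcm⟩ := Filter.frequently_atTop.1 hc N
  exact hno m hm fun d hd => ⟨c, hcm, key m hm d hd⟩

/-- The parity condition on latest appearance records expresses the Emerson-Lei condition. -/
theorem parityWin_iff (hr : ∀ n, r (n + 1) = upd (r n) (C n)) (acc : Set κ → Prop) :
    ParityWin (fun n => prio acc (r n) (C n)) ↔ acc {c | ∃ᶠ n in Filter.atTop, c ∈ C n} := by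
  have hsub := eventually_hit_subset hr
  have hfreq := (frequently_subset_hit hr).and_eventually hsub
  set F := {c | ∃ᶠ n in Filter.atTop, c ∈ C n} with hF
  constructor
  · intro hwin
    by_contra hacc
    refine hwin (2 * F.ncard + 1) ⟨_, rfl⟩ ?_ ?_
    · filter_upwards [hsub] with n hn
      have := Set.ncard_le_ncard hn
      unfold prio
      split_ifs <;> omega
    · refine hfreq.mono fun n hn => ?_
      change prio acc (r n) (C n) = _
      rw [prio, hn.2.antisymm hn.1, if_neg hacc]
  · rintro hacc t ⟨s, rfl⟩ hle hinf
    simp only at hle hinf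
    obtain ⟨n, hn, hn'⟩ := (hfreq.and_eventually hle).exists
    obtain ⟨m, hm, hm'⟩ := (hinf.and_eventually hsub).exists
    have hFs : F.ncard ≤ s := by
      rw [prio, hn.2.antisymm hn.1, if_pos hacc] at hn'
      omega
    have hms : s = (hit (r m) (C m)).ncard ∧ ¬ acc (hit (r m) (C m)) := by
      unfold prio at hm
      split_ifs at hm with h
      · omega
      · exact ⟨by omega, h⟩
    have : hit (r m) (C m) = F := Set.eq_of_subset_of_ncard_le hm' (by omega)
    exact hms.2 (this ▸ hacc)

end LatestAppearance

namespace LTL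

variable {AP : Type}

/-- The occurrences of subformulas of a formula, starting with the formula itself. -/
def subs : LTL AP → List (LTL AP)
  | .tt => [.tt]
  | .ff => [.ff]
  | .atom p => [.atom p]
  | .not f => .not f :: f.subs
  | .and f g => .and f g :: (f.subs ++ g.subs)
  | .or f g => .or f g :: (f.subs ++ g.subs)
  | .next f => .next f :: f.subs
  | .untl f g => .untl f g :: (f.subs ++ g.subs)
  | .release f g => .release f g :: (f.subs ++ g.subs)
  | .ev f => .ev f :: f.subs
  | .glob f => .glob f :: f.subs

lemma length_subs (f : LTL AP) : f.subs.length = f.size := by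
  induction f <;> simp_all [subs, size]

lemma mem_subs_self (f : LTL AP) : f ∈ f.subs := by
  cases f <;> simp [subs]

end LTL

section Semantics

variable {AP : Type}

/-- The word with first letter `a` and tail `w`. -/
def consWord (a : Set AP) (w : ℕ → Set AP) : ℕ → Set AP
  | 0 => a
  | n + 1 => w n

lemma consWord_tail (w : ℕ → Set AP) : consWord (w 0) (fun n => w (n + 1)) = w := by
  funext n; cases n <;> rfl

lemma sat_glob_consWord {a : Set AP} {w : ℕ → Set AP} {f : LTL AP} :
    LTLSat (consWord a w) (.glob f) ↔ LTLSat (consWord a w) f ∧ LTLSat w (.glob f) :=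
  Nat.and_forall_add_one.symm

lemma sat_ev_consWord {a : Set AP} {w : ℕ → Set AP} {f : LTL AP} :
    LTLSat (consWord a w) (.ev f) ↔ LTLSat (consWord a w) f ∨ LTLSat w (.ev f) :=
  Nat.or_exists_add_one.symm

lemma sat_untl_consWord {a : Set AP} {w : ℕ → Set AP} {f g : LTL AP} :
    LTLSat (consWord a w) (.untl f g) ↔
      LTLSat (consWord a w) g ∨ LTLSat (consWord a w) f ∧ LTLSat w (.untl f g) := by
  simp only [LTLSat]
  rw [← Nat.or_exists_add_one]
  refine or_congr ⟨fun h => h.1, fun h => ⟨h, fun j hj => absurd hj (Nat.not_lt_zero j)⟩⟩ ?_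
  simp only [Nat.forall_lt_succ_left]
  exact ⟨fun ⟨i, h1, h2, h3⟩ => ⟨h2, i, h1, h3⟩, fun ⟨h2, i, h1, h3⟩ => ⟨i, h1, h2, h3⟩⟩

lemma sat_release_consWord {a : Set AP} {w : ℕ → Set AP} {f g : LTL AP} :
    LTLSat (consWord a w) (.release f g) ↔
      LTLSat (consWord a w) g ∧ (LTLSat (consWord a w) f ∨ LTLSat w (.release f g)) := by
  simp only [LTLSat]
  rw [← Nat.and_forall_add_one]
  refine and_congr ⟨fun h => h.resolve_right fun ⟨j, hj, _⟩ => Nat.not_lt_zero j hj, Or.inl⟩ ?_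
  simp only [Nat.exists_lt_succ_left, ← forall_or_left]
  exact forall_congr' fun i => or_left_comm

lemma sat_consWord_congr (a : Set AP) {w w' : ℕ → Set AP} (f : LTL AP)
    (h : ∀ g ∈ f.subs, (LTLSat w g ↔ LTLSat w' g)) :
    ∀ g ∈ f.subs, (LTLSat (consWord a w) g ↔ LTLSat (consWord a w') g) := by
  have hself := h f f.mem_subs_self
  induction f with
  | tt | ff => simp [LTL.subs, LTLSat]
  | atom p => simp [LTL.subs, LTLSat, consWord]
  | not f ih =>
    simp only [LTL.subs, List.forall_mem_cons] at h ⊢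
    have hf := ih h.2 (h.2 _ f.mem_subs_self)
    exact ⟨not_congr (hf f f.mem_subs_self), hf⟩
  | next f ih =>
    simp only [LTL.subs, List.forall_mem_cons] at h ⊢
    exact ⟨h.2 _ f.mem_subs_self, ih h.2 (h.2 _ f.mem_subs_self)⟩
  | ev f ih =>
    simp only [LTL.subs, List.forall_mem_cons] at h ⊢
    have hf := ih h.2 (h.2 _ f.mem_subs_self)
    refine ⟨?_, hf⟩
    rw [sat_ev_consWord, sat_ev_consWord, hself, hf f f.mem_subs_self]
  | glob f ih =>
    simp only [LTL.subs, List.forall_mem_cons] at h ⊢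
    have hf := ih h.2 (h.2 _ f.mem_subs_self)
    refine ⟨?_, hf⟩
    rw [sat_glob_consWord, sat_glob_consWord, hself, hf f f.mem_subs_self]
  | and f g ihf ihg | or f g ihf ihg | untl f g ihf ihg | release f g ihf ihg =>
    simp only [LTL.subs, List.forall_mem_cons, List.forall_mem_append] at h ⊢
    have hf := ihf h.2.1 (h.2.1 _ f.mem_subs_self)
    have hg := ihg h.2.2 (h.2.2 _ g.mem_subs_self)
    refine ⟨?_, hf, hg⟩
    have hf' := hf f f.mem_subs_self
    have hg' := hg g g.mem_subs_self
    first
    | exact and_congr hf' hg'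
    | exact or_congr hf' hg'
    | rw [sat_untl_consWord, sat_untl_consWord, hself, hf', hg']
    | rw [sat_release_consWord, sat_release_consWord, hself, hf', hg']

/-- The subformula occurrences of `f` that hold on the word `w`. -/
def satSubs (f : LTL AP) (w : ℕ → Set AP) : Set (Fin f.subs.length) :=
  {i | LTLSat w (f.subs.get i)}

lemma satSubs_eq_iff {f : LTL AP} {w w' : ℕ → Set AP} :
    satSubs f w = satSubs f w' ↔ ∀ g ∈ f.subs, (LTLSat w g ↔ LTLSat w' g) := by
  rw [Set.ext_iff, List.forall_mem_iff_get]
  rfl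

/-- Residuals of a language determined by `satSubs f` are determined by `satSubs f`. -/
lemma exists_residual (f : LTL AP) (P : Set (Set (Fin f.subs.length))) (a : Set AP) :
    ∃ P' : Set (Set (Fin f.subs.length)),
      ∀ w, satSubs f w ∈ P' ↔ satSubs f (consWord a w) ∈ P := by
  refine ⟨{T | ∃ w, satSubs f w = T ∧ satSubs f (consWord a w) ∈ P}, fun w => ⟨?_, fun h =>
    ⟨w, rfl, h⟩⟩⟩
  rintro ⟨w', hw, hP⟩
  rwa [satSubs_eq_iff.2 (sat_consWord_congr a f (satSubs_eq_iff.1 hw))] at hP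

lemma exists_initial (f : LTL AP) :
    ∃ P : Set (Set (Fin f.subs.length)), ∀ w, satSubs f w ∈ P ↔ LTLSat w f := by
  refine ⟨{T | ∃ w, satSubs f w = T ∧ LTLSat w f}, fun w => ⟨?_, fun h => ⟨w, rfl, h⟩⟩⟩
  rintro ⟨w', hw, h⟩
  exact (satSubs_eq_iff.1 hw f f.mem_subs_self).1 h

lemma satSubs_mem_iff_of_run {f : LTL AP}
    {next : Set (Set (Fin f.subs.length)) → Set AP → Set (Set (Fin f.subs.length))}
    (hnext : ∀ P a w, satSubs f w ∈ next P a ↔ satSubs f (consWord a w) ∈ P)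
    {w : ℕ → Set AP} {q : ℕ → Set (Set (Fin f.subs.length))} (N : ℕ)
    (hq : ∀ i < N, q (i + 1) = next (q i) (w i)) :
    satSubs f w ∈ q 0 ↔ satSubs f (fun n => w (n + N)) ∈ q N := by
  induction N with
  | zero => rfl
  | succ N ih =>
    rw [ih fun i hi => hq i (by omega), hq N (by omega), hnext]
    have := consWord_tail fun n => w (n + N)
    simp only [Nat.zero_add, Nat.add_right_comm _ 1 N] at this
    rw [← this]
    rfl

/-- A word violating a safety formula has a finite bad prefix. -/
lemma IsSafety.exists_refuting_length {f : LTL AP} (hf : IsSafety f) {w : ℕ → Set AP}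
    (hw : ¬ LTLSat w f) : ∃ N, ∀ w', (∀ i < N, w' i = w i) → ¬ LTLSat w' f := by
  induction f generalizing w with
  | tt => exact (hw trivial).elim
  | ff => exact ⟨0, fun _ _ h => h⟩
  | atom p =>
    refine ⟨1, fun w' h => ?_⟩
    simpa only [LTLSat, h 0 Nat.one_pos] using hw
  | not f =>
    cases f with
    | atom p =>
      refine ⟨1, fun w' h => ?_⟩
      simpa only [LTLSat, h 0 Nat.one_pos] using hw
    | _ => exact hf.elim
  | and f g ihf ihg =>
    rcases not_and_or.1 hw with h | h
    · obtain ⟨N, hN⟩ := ihf hf.1 h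
      exact ⟨N, fun w' h hs => hN w' h hs.1⟩
    · obtain ⟨N, hN⟩ := ihg hf.2 h
      exact ⟨N, fun w' h hs => hN w' h hs.2⟩
  | or f g ihf ihg =>
    obtain ⟨N, hN⟩ := ihf hf.1 fun h => hw (Or.inl h)
    obtain ⟨M, hM⟩ := ihg hf.2 fun h => hw (Or.inr h)
    exact ⟨max N M, fun w' h hs => hs.elim
      (hN w' fun i hi => h i (lt_max_of_lt_left hi))
      (hM w' fun i hi => h i (lt_max_of_lt_right hi))⟩
  | next f ih =>
    obtain ⟨N, hN⟩ := ih hf hw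
    exact ⟨N + 1, fun w' h => hN _ fun i hi => h (i + 1) (by omega)⟩
  | untl f g => exact hf.elim
  | ev f => exact hf.elim
  | glob f ih =>
    obtain ⟨i, hi⟩ := not_forall.1 hw
    obtain ⟨N, hN⟩ := ih hf hi
    exact ⟨N + i, fun w' h hs => hN _ (fun j hj => h (j + i) (by omega)) (hs i)⟩
  | release f g ihf ihg =>
    simp only [LTLSat, not_forall, not_or, not_exists, not_and] at hw
    obtain ⟨i, hg, hfs⟩ := hw
    obtain ⟨N, hN⟩ := ihg hf.2 hg
    have (j : ℕ) : ∃ M, j < i → ∀ w', (∀ k < M, w' k = w (k + j)) → ¬ LTLSat w' f := by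
      by_cases hj : j < i
      · obtain ⟨M, hM⟩ := ihf hf.1 (hfs j hj)
        exact ⟨M, fun _ => hM⟩
      · exact ⟨0, fun h => (hj h).elim⟩
    choose M hM using this
    refine ⟨max (N + i) ((Finset.range i).sup fun j => M j + j), fun w' h hs => ?_⟩
    rcases hs i with hs | ⟨j, hj, hs⟩
    · exact hN _ (fun k hk => h (k + i) (lt_max_of_lt_left (by omega))) hs
    · refine hM j hj _ (fun k hk => h (k + j) (lt_max_of_lt_right ?_)) hs
      have := Finset.le_sup (f := fun j => M j + j) (Finset.mem_range.2 hj)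
      omega

lemma IsBool.sat_congr {f : LTL AP} (hf : IsBool f) {w w' : ℕ → Set AP} (h : w 0 = w' 0) :
    LTLSat w f ↔ LTLSat w' f := by
  induction f with
  | tt | ff => rfl
  | atom p => simp only [LTLSat, h]
  | not f ih => exact not_congr (ih hf)
  | and f g ihf ihg => exact and_congr (ihf hf.1) (ihg hf.2)
  | or f g ihf ihg => exact or_congr (ihf hf.1) (ihg hf.2)
  | _ => exact hf.elim

/-- The Boolean formulas whose infinite occurrence determines an Emerson-Lei formula. -/
def LTL.colours : LTL AP → List (LTL AP)
  | .and f g => f.colours ++ g.colours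
  | .or f g => f.colours ++ g.colours
  | .glob (.ev ψ) => [ψ]
  | .ev (.glob ψ) => [.not ψ]
  | _ => []

/-- The letter `a` satisfies the Boolean formula `f`. -/
def LetterSat (a : Set AP) (f : LTL AP) : Prop := LTLSat (fun _ => a) f

lemma IsEL.two_mul_length_colours_lt {f : LTL AP} (hf : IsEL f) :
    2 * f.colours.length < f.size := by
  fun_induction IsEL f with
  | case1 f g ihf ihg | case2 f g ihf ihg =>
    have := ihf hf.1
    have := ihg hf.2
    simp only [LTL.colours, LTL.size, List.length_append]
    omega
  | case3 ψ | case4 ψ =>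
    have : 0 < ψ.size := by cases ψ <;> simp [LTL.size]
    simp only [LTL.colours, LTL.size, List.length_singleton]
    omega
  | case5 => exact hf.elim

lemma sat_glob_ev_iff {ψ : LTL AP} (hψ : IsBool ψ) (w : ℕ → Set AP) :
    LTLSat w (.glob (.ev ψ)) ↔ ∃ᶠ n in Filter.atTop, LetterSat (w n) ψ := by
  rw [Filter.frequently_atTop]
  simp only [LTLSat, LetterSat]
  refine forall_congr' fun i => ⟨fun ⟨j, hj⟩ => ⟨j + i, by omega, (hψ.sat_congr (by simp)).1 hj⟩,
    fun ⟨j, hj, h⟩ => ⟨j - i, (hψ.sat_congr ?_).1 h⟩⟩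
  simp [Nat.sub_add_cancel hj]

lemma sat_ev_glob_iff {ψ : LTL AP} (hψ : IsBool ψ) (w : ℕ → Set AP) :
    LTLSat w (.ev (.glob ψ)) ↔ ¬ ∃ᶠ n in Filter.atTop, LetterSat (w n) (.not ψ) := by
  rw [← sat_glob_ev_iff (ψ := .not ψ) hψ]
  simp only [LTLSat, not_forall, not_exists, not_not]

lemma IsEL.sat_congr {f : LTL AP} (hf : IsEL f) {w w' : ℕ → Set AP}
    (h : ∀ g ∈ f.colours, ((∃ᶠ n in Filter.atTop, LetterSat (w n) g) ↔
      ∃ᶠ n in Filter.atTop, LetterSat (w' n) g)) :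
    LTLSat w f ↔ LTLSat w' f := by
  fun_induction IsEL f with
  | case1 f g ihf ihg =>
    simp only [LTL.colours, List.forall_mem_append] at h
    exact and_congr (ihf hf.1 h.1) (ihg hf.2 h.2)
  | case2 f g ihf ihg =>
    simp only [LTL.colours, List.forall_mem_append] at h
    exact or_congr (ihf hf.1 h.1) (ihg hf.2 h.2)
  | case3 ψ =>
    rw [sat_glob_ev_iff hf, sat_glob_ev_iff hf]
    exact h ψ (by simp [LTL.colours])
  | case4 ψ =>
    rw [sat_ev_glob_iff hf, sat_ev_glob_iff hf]
    exact not_congr (h _ (by simp [LTL.colours]))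
  | case5 => exact hf.elim

/-- The indices of the colours of `f` satisfied by a letter. -/
def LTL.letterColours (f : LTL AP) (a : Set AP) : Set (Fin f.colours.length) :=
  {i | LetterSat a (f.colours.get i)}

lemma IsEL.exists_acceptance {f : LTL AP} (hf : IsEL f) :
    ∃ acc : Set (Fin f.colours.length) → Prop, ∀ w : ℕ → Set AP,
      LTLSat w f ↔ acc {c | ∃ᶠ n in Filter.atTop, c ∈ f.letterColours (w n)} := by
  refine ⟨fun F => ∃ w : ℕ → Set AP,
    {c | ∃ᶠ n in Filter.atTop, c ∈ f.letterColours (w n)} = F ∧ LTLSat w f,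
    fun w => ⟨fun h => ⟨w, rfl, h⟩, ?_⟩⟩
  rintro ⟨w', hw, h⟩
  refine (hf.sat_congr ?_).1 h
  rw [List.forall_mem_iff_get]
  exact fun i => Set.ext_iff.1 hw i

end Semantics

/-- If a safety and Emerson-Lei formula `φ = φ_safety ∧ φ_EL` over `AP = I ⊎ O` is
realizable, then it is realized by a finite-state strategy: a Mealy machine with at most
`2^(2^n) · e · m!` states, where `n = |φ_safety|`, `m = |φ_EL|` and `e` is Euler's
number. -/
theorem realizable_implies_finite_state_realization
    {I O : Type} [Fintype I] [Fintype O]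
    (φs φel : LTL (I ⊕ O)) (hs : IsSafety φs) (hel : IsEL φel)
    (hreal : Realizable (φs.and φel)) :
    ∃ Mm : Mealy I O, Mm.Realizes (φs.and φel) ∧
      (Fintype.card Mm.M : ℝ) ≤
        2 ^ (2 ^ φs.size) * (Real.exp 1 * (Nat.factorial φel.size)) := by
  classical
  obtain ⟨σ, hσ⟩ := hreal
  obtain ⟨q0, hq0⟩ := exists_initial φs
  choose next hnext using exists_residual φs
  obtain ⟨acc, hacc⟩ := hel.exists_acceptance
  let k := φel.colours.length
  have hk : 2 * k < φel.size := hel.two_mul_length_colours_lt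
  let S : Type := Set (Set (Fin φs.subs.length)) × (Fin k → Fin (k + 1))
  let s0 : S := (q0, fun _ => 0)
  let rank : S → Fin k → ℕ := fun s c => s.2 c
  let step : S → Set I → Set O → S := fun s a b =>
    (next s.1 (combine a b), fun c =>
      ⟨LatestAppearance.upd (rank s) (φel.letterColours (combine a b)) c,
        Nat.lt_succ_of_le ((LatestAppearance.upd_le _ _ c).trans_eq (Fintype.card_fin k))⟩)
  let prio : S → Set I → Set O → ℕ := fun s a b =>
    LatestAppearance.prio acc (rank s) (φel.letterColours (combine a b))
  have hprio (x : ℕ → Set I) (b : ℕ → Set O) (v : ℕ → S)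
      (hv : ∀ n, v (n + 1) = step (v n) (x n) (b n)) :
      ParityWin (fun n => prio (v n) (x n) (b n)) ↔
        LTLSat (fun n => combine (x n) (b n)) φel := by
    rw [hacc]
    refine LatestAppearance.parityWin_iff (r := fun n => rank (v n))
      (C := fun n => φel.letterColours (combine (x n) (b n))) (fun n => ?_) acc
    simp only [hv n, rank, step]
    rfl
  obtain ⟨out, hout⟩ := ParityGame.exists_positional σ step s0 prio (2 * k + 2)
    (fun s a b => (LatestAppearance.prio_lt _ _ _).trans_eq (by rw [Fintype.card_fin]))
    (fun x => (hprio x (ParityGame.outAt σ x) _ fun n => rfl).2 (hσ x).2)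
  let Mm : Mealy I O := { M := S, m0 := s0, δ := fun s a => step s a (out s a), out := out }
  refine ⟨Mm, fun x => ?_, ?_⟩
  · obtain ⟨hreach, hpar⟩ := hout x (Mm.stateAt x) rfl fun n => rfl
    refine ⟨?_, (hprio x _ _ fun n => rfl).1 hpar⟩
    by_contra hbad
    obtain ⟨N, hN⟩ := hs.exists_refuting_length hbad
    obtain ⟨y, m, hym⟩ := hreach N
    have hplay := (satSubs_mem_iff_of_run hnext m
      (w := fun n => combine (y n) (ParityGame.outAt σ y n))
      (q := fun n => (ParityGame.runAt σ step s0 y n).1) fun i _ => rfl).1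
      ((hq0 _).2 (hσ y).1)
    simp only [hym] at hplay
    let w' : ℕ → Set (I ⊕ O) := fun n =>
      if n < N then combine (x n) (Mm.out (Mm.stateAt x n) (x n))
      else combine (y (n - N + m)) (ParityGame.outAt σ y (n - N + m))
    refine hN w' (fun i hi => if_pos hi) ((hq0 w').1 ?_)
    refine (satSubs_mem_iff_of_run hnext N (w := w') (q := fun n => (Mm.stateAt x n).1)
      fun i hi => ?_).2 ?_
    · simp only [w', if_pos hi]
      rfl
    · have : (fun n => w' (n + N)) =
          fun n => combine (y (n + m)) (ParityGame.outAt σ y (n + m)) := by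
        funext n
        simp [w']
      rw [this]
      exact hplay
  · have hcard : Fintype.card Mm.M = 2 ^ 2 ^ φs.size * (k + 1) ^ k := by
      change Fintype.card (Set (Set (Fin φs.subs.length)) × (Fin k → Fin (k + 1))) = _
      simp [Fintype.card_prod, Fintype.card_set, LTL.length_subs]
    have hfact : (k + 1) ^ k ≤ φel.size.factorial :=
      calc (k + 1) ^ k ≤ k.factorial * (k + 1) ^ k :=
            Nat.le_mul_of_pos_left _ (Nat.factorial_pos k)
        _ ≤ (k + k).factorial := Nat.factorial_mul_pow_le_factorial
        _ ≤ φel.size.factorial := Nat.factorial_le (by omega)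
    rw [hcard]
    push_cast
    refine mul_le_mul_of_nonneg_left ?_ (by positivity)
    calc ((k : ℝ) + 1) ^ k ≤ (φel.size.factorial : ℝ) := by exact_mod_cast hfact
      _ ≤ Real.exp 1 * φel.size.factorial :=
        le_mul_of_one_le_left (by positivity) (Real.one_le_exp zero_le_one)
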